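/- Let R̂, G, ℒ, T be as follows: R̂ : ℝ × ℝ^d → ℂ measurable with |R̂(ω,p)| ≤ G(p), G ∈ L¹(ℝ^d); ℒ the bounded operator on L²(ℝ^{2d}) given by (ℒλ)(x,k) = (2π)^{−d} ∫ R̂((|p|²−|k|²)/2, p−k)(λ(x,p) − λ(x,k)) dp; T(z) the free transport isometry (T(z)u)(x,k) = u(x − zk, k) on L²(ℝ^{2d}). Let ℒ₂ be the two-particle operator on L²(ℝ^{4d}) acting as ℒ in the (x₁,k₁) variables plus ℒ in the (x₂,k₂) variables, and T₂(z) the two-particle transport isometry (T₂(z)v)(x₁,k₁,x₂,k₂) = v(x₁ − z k₁, k₁, x₂ − z k₂, k₂). Fix L > 0 and W₀ ∈ L²(ℝ^{2d}). If W : [0,L] → L²(ℝ^{2d}) is continuous and satisfies W(z) = T(z)W₀ + ∫₀^z T(z−s) ℒ W(s) ds, and V : [0,L] → L²(ℝ^{4d}) is continuous and satisfies V(z) = T₂(z)(W₀ ⊗ W₀) + ∫₀^z T₂(z−s) ℒ₂ V(s) ds, then V(z) = W(z) ⊗ W(z) for every z ∈ [0,L]. -/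

import Mathlib

open MeasureTheory Filter Topology

theorem tmeas {X Y : Type*} [MeasureSpace X] [MeasureSpace Y] [SigmaFinite (volume : Measure X)] [SigmaFinite (volume : Measure Y)]
   (u : Lp ℂ 2 (volume : Measure X)) (v : Lp ℂ 2 (volume : Measure Y)) :
   eLpNorm (fun q : X × Y => u q.1 * v q.2) 2 volume = eLpNorm u 2 volume * eLpNorm v 2 volume := by
  have e2 : (2:ENNReal) ≠ 0 := by norm_num
  have e3 : (2:ENNReal) ≠ ⊤ := by norm_num
  rw [eLpNorm_eq_lintegral_rpow_enorm_toReal e2 e3, eLpNorm_eq_lintegral_rpow_enorm_toReal e2 e3,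
    eLpNorm_eq_lintegral_rpow_enorm_toReal e2 e3, ← ENNReal.mul_rpow_of_nonneg _ _ (by positivity),
    Measure.volume_eq_prod, ← lintegral_prod_mul]
  · congr 2
    funext q
    rw [enorm_mul, ENNReal.mul_rpow_of_nonneg _ _ (by positivity)]
  · exact ((Lp.aestronglyMeasurable u).enorm.pow_const _)
  · exact ((Lp.aestronglyMeasurable v).enorm.pow_const _)

theorem tmem {X Y : Type*} [MeasureSpace X] [MeasureSpace Y] [SigmaFinite (volume : Measure X)] [SigmaFinite (volume : Measure Y)]
   (u : Lp ℂ 2 (volume : Measure X)) (v : Lp ℂ 2 (volume : Measure Y)) :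
   MemLp (fun q : X × Y => u q.1 * v q.2) 2 volume := by
  refine ⟨(Lp.aestronglyMeasurable u).comp_fst.mul (Lp.aestronglyMeasurable v).comp_snd, ?_⟩
  rw [tmeas]
  exact ENNReal.mul_lt_top (Lp.eLpNorm_lt_top u) (Lp.eLpNorm_lt_top v)

theorem ae1 {X Y : Type*} [MeasureSpace X] [MeasureSpace Y] [SigmaFinite (volume : Measure X)] [SigmaFinite (volume : Measure Y)]
  {p : X → Prop} (h : ∀ᵐ x, p x) : ∀ᵐ q : X × Y, p q.1 := 
  (Measure.quasiMeasurePreserving_fst (μ := (volume : Measure X)) (ν := (volume : Measure Y))).ae h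

theorem ae2 {X Y : Type*} [MeasureSpace X] [MeasureSpace Y] [SigmaFinite (volume : Measure X)] [SigmaFinite (volume : Measure Y)]
  {p : Y → Prop} (h : ∀ᵐ x, p x) : ∀ᵐ q : X × Y, p q.2 := 
  (Measure.quasiMeasurePreserving_snd (μ := (volume : Measure X)) (ν := (volume : Measure Y))).ae h

/-- tensor product -/
noncomputable def tens (X Y : Type*) [MeasureSpace X] [MeasureSpace Y] [SigmaFinite (volume : Measure X)] [SigmaFinite (volume : Measure Y)] :
    Lp ℂ 2 (volume : Measure X) →L[ℝ] Lp ℂ 2 (volume : Measure Y) →L[ℝ] Lp ℂ 2 (volume : Measure (X × Y)) :=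
  LinearMap.mkContinuous₂ (LinearMap.mk₂ ℝ (fun u v => (tmem u v).toLp _)
    (by
      intro u u' v
      rw [← MemLp.toLp_add, MemLp.toLp_eq_toLp_iff]
      filter_upwards [ae1 (Lp.coeFn_add u u')] with q hq
      simp only [hq, Pi.add_apply, add_mul])
    (by
      intro c u v
      rw [← MemLp.toLp_const_smul, MemLp.toLp_eq_toLp_iff]
      filter_upwards [ae1 (Lp.coeFn_smul c u)] with q hq
      simp [hq, mul_assoc])
    (by
      intro u v v'
      rw [← MemLp.toLp_add, MemLp.toLp_eq_toLp_iff]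
      filter_upwards [ae2 (Lp.coeFn_add v v')] with q hq
      simp only [hq, Pi.add_apply, mul_add])
    (by
      intro c u v
      rw [← MemLp.toLp_const_smul, MemLp.toLp_eq_toLp_iff]
      filter_upwards [ae2 (Lp.coeFn_smul c v)] with q hq
      simp [hq, mul_left_comm])) 1 (by
      intro u v
      rw [LinearMap.mk₂_apply, Lp.norm_toLp, tmeas, one_mul, ENNReal.toReal_mul, Lp.norm_def, Lp.norm_def])

theorem tens_ae {X Y : Type*} [MeasureSpace X] [MeasureSpace Y] [SigmaFinite (volume : Measure X)] [SigmaFinite (volume : Measure Y)]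
   (u : Lp ℂ 2 (volume : Measure X)) (v : Lp ℂ 2 (volume : Measure Y)) :
   (tens X Y u v : X × Y → ℂ) =ᵐ[volume] fun q => u q.1 * v q.2 :=
  MemLp.coeFn_toLp (tmem u v)

theorem flow {X : Type*} [TopologicalSpace X] [MeasureSpace X] [BorelSpace X] [R1Space X]
   [(volume : Measure X).InnerRegularCompactLTTop] [IsLocallyFiniteMeasure (volume : Measure X)]
   (S : ℝ → X → X) (hS : Continuous (Function.uncurry S)) (hm : ∀ z, MeasurePreserving (S z))
   (h0 : ∀ x, S 0 x = x) (hadd : ∀ a b x, S (a + b) x = S b (S a x))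
   (T : ℝ → (Lp ℂ 2 (volume : Measure X) →L[ℂ] Lp ℂ 2 (volume : Measure X)))
   (hT : ∀ z u, (T z u : X → ℂ) =ᵐ[volume] fun x => u (S z x)) :
   Continuous (fun p : ℝ × Lp ℂ 2 (volume : Measure X) => T p.1 p.2) ∧ (∀ u, T 0 u = u) ∧
   (∀ a b u, T (a + b) u = T a (T b u)) ∧ ∀ z u, ‖T z u‖ = ‖u‖ := by
  have key : ∀ z u, T z u = Lp.compMeasurePreserving (S z) (hm z) u := by
    intro z u
    apply Lp.ext
    exact (hT z u).trans (Lp.coeFn_compMeasurePreserving u (hm z)).symm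
  refine ⟨?_, ?_, ?_, ?_⟩
  · simp_rw [key]
    exact Continuous.compMeasurePreservingLp (f := fun p : ℝ × Lp ℂ 2 (volume : Measure X) => p.2)
      (g := fun p => ContinuousMap.curry ⟨Function.uncurry S, hS⟩ p.1) continuous_snd
      ((ContinuousMap.curry ⟨Function.uncurry S, hS⟩).continuous.comp continuous_fst) (fun p => hm p.1) (by norm_num)
  · intro u
    apply Lp.ext
    filter_upwards [hT 0 u] with x hx
    rw [hx, h0]
  · intro a b u
    apply Lp.ext
    filter_upwards [hT (a + b) u, hT a (T b u), (hm a).quasiMeasurePreserving.ae (hT b u)] with x h1 h2 h3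
    rw [h1, h2, h3, hadd]
  · intro z u
    rw [key, Lp.norm_compMeasurePreserving]


theorem mild {H : Type*} [NormedAddCommGroup H] [NormedSpace ℂ H] [CompleteSpace H]
   (T : ℝ → H →L[ℂ] H) (hc : Continuous (fun p : ℝ × H => T p.1 p.2)) (h0 : ∀ u, T 0 u = u)
   (hadd : ∀ a b u, T (a + b) u = T a (T b u)) (A : H →L[ℂ] H) (L : ℝ) (hL : 0 < L) (W₀ : H) (W : ℝ → H)
    (hWcont : ContinuousOn W (Set.Icc 0 L))
    (hW : ∀ z ∈ Set.Icc (0 : ℝ) L, W z = T z W₀ + ∫ s in (0 : ℝ)..z, T (z - s) (A (W s))) :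
    ∃ Y : ℝ → H, Continuous Y ∧ Y 0 = W₀ ∧ (∀ z ∈ Set.Icc (0 : ℝ) L, Y z = T (-z) (W z)) ∧
      ∀ z ∈ Set.Icc (0 : ℝ) L, HasDerivAt Y (T (-z) (A (W z))) z := by
  have hf : ContinuousOn (fun s => T (-s) (A (W s))) (Set.Icc 0 L) :=
    hc.comp_continuousOn (continuousOn_neg.prodMk (A.continuous.comp_continuousOn hWcont))
  set f := fun s => T (-s) (A (W s)) with hfdef
  set F := Set.IccExtend hL.le ((Set.Icc 0 L).domRestrict f) with hF
  have hFc : Continuous F := (continuousOn_iff_continuous_domRestrict.1 hf).Icc_extend'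
  have hFf : ∀ z ∈ Set.Icc (0:ℝ) L, F z = f z := fun z hz => by
    rw [hF, Set.IccExtend_of_mem _ _ hz]; rfl
  have hd : ∀ z, HasDerivAt (fun z => W₀ + ∫ s in (0:ℝ)..z, F s) (F z) z := fun z =>
    (intervalIntegral.integral_hasDerivAt_right (hFc.intervalIntegrable _ _)
      hFc.aestronglyMeasurable.stronglyMeasurableAtFilter hFc.continuousAt).const_add _
  refine ⟨fun z => W₀ + ∫ s in (0:ℝ)..z, F s, ?_, by simp, ?_, ?_⟩
  · exact continuous_iff_continuousAt.2 fun z => (hd z).continuousAt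
  · intro z hz
    have hinv : ∀ u, T (-z) (T z u) = u := fun u => by rw [← hadd, neg_add_cancel, h0]
    have e1 : ∫ s in (0 : ℝ)..z, T (z - s) (A (W s)) = T z (∫ s in (0:ℝ)..z, F s) := by
      rw [← ContinuousLinearMap.intervalIntegral_comp_comm _ (hFc.intervalIntegrable _ _)]
      apply intervalIntegral.integral_congr
      intro s hs
      rw [Set.uIcc_of_le hz.1] at hs
      simp only
      rw [hFf s ⟨hs.1, hs.2.trans hz.2⟩, hfdef, ← hadd, sub_eq_add_neg]
    rw [hW z hz, e1, map_add, hinv, hinv]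
  · intro z hz
    have := hd z
    rwa [hFf z hz] at this

theorem abs_main {H K : Type*} [NormedAddCommGroup H] [NormedSpace ℂ H] [CompleteSpace H]
   [NormedAddCommGroup K] [NormedSpace ℂ K] [CompleteSpace K]
   (T : ℝ → H →L[ℂ] H) (hc : Continuous (fun p : ℝ × H => T p.1 p.2)) (h0 : ∀ u, T 0 u = u)
   (hadd : ∀ a b u, T (a + b) u = T a (T b u))
   (T2 : ℝ → K →L[ℂ] K) (hc2 : Continuous (fun p : ℝ × K => T2 p.1 p.2)) (h02 : ∀ u, T2 0 u = u)
   (hadd2 : ∀ a b u, T2 (a + b) u = T2 a (T2 b u)) (hn2 : ∀ z u, ‖T2 z u‖ = ‖u‖)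
   (A : H →L[ℂ] H) (A2 : K →L[ℂ] K) (B : H →L[ℝ] H →L[ℝ] K)
   (hBT : ∀ z u v, T2 z (B u v) = B (T z u) (T z v))
   (hBA : ∀ u v, A2 (B u v) = B (A u) v + B u (A v))
   (L : ℝ) (hL : 0 < L) (W₀ : H) (W : ℝ → H)
    (hWcont : ContinuousOn W (Set.Icc 0 L))
    (hW : ∀ z ∈ Set.Icc (0 : ℝ) L, W z = T z W₀ + ∫ s in (0 : ℝ)..z, T (z - s) (A (W s)))
    (V : ℝ → K)
    (hVcont : ContinuousOn V (Set.Icc 0 L))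
    (hV : ∀ z ∈ Set.Icc (0 : ℝ) L, V z = T2 z (B W₀ W₀) + ∫ s in (0 : ℝ)..z, T2 (z - s) (A2 (V s))) :
    ∀ z ∈ Set.Icc (0 : ℝ) L, V z = B (W z) (W z) := by
  obtain ⟨Y, Yc, Y0, Ye, Yd⟩ := mild T hc h0 hadd A L hL W₀ W hWcont hW
  obtain ⟨Z, Zc, Z0, Ze, Zd⟩ := mild T2 hc2 h02 hadd2 A2 L hL _ V hVcont hV
  have hinv : ∀ z u, T2 z (T2 (-z) u) = u := fun z u => by rw [← hadd2, add_neg_cancel, h02]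
  have hinv1 : ∀ z u, T z (T (-z) u) = u := fun z u => by rw [← hadd, add_neg_cancel, h0]
  have key := ODE_solution_unique_of_mem_Icc_right (v := fun t y => T2 (-t) (A2 (T2 t y)))
    (s := fun _ => Set.univ) (K := ‖A2‖₊) (f := Z) (g := fun t => B (Y t) (Y t)) (a := 0) (b := L)
    ?_ Zc.continuousOn ?_ (fun _ _ => Set.mem_univ _) ?_ ?_ (fun _ _ => Set.mem_univ _) ?_
  · intro z hz
    have h := key hz
    simp only at h
    rw [Ze z hz, Ye z hz, ← hBT] at h
    have := congrArg (T2 z) h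
    rwa [hinv, hinv] at this
  · intro t _
    apply LipschitzWith.lipschitzOnWith
    apply LipschitzWith.of_dist_le_mul
    intro x y
    rw [dist_eq_norm, dist_eq_norm, ← map_sub, ← map_sub, ← map_sub, hn2, coe_nnnorm]
    refine (A2.le_opNorm _).trans ?_
    rw [hn2]
  · intro t ht
    have ht' := Set.Ico_subset_Icc_self ht
    rw [Ze t ht', hinv]
    exact (Zd t ht').hasDerivWithinAt
  · exact ((B.continuous.comp Yc).clm_apply Yc).continuousOn
  · intro t ht
    have ht' := Set.Ico_subset_Icc_self ht
    have h := B.hasDerivWithinAt_of_bilinear (Yd t ht').hasDerivWithinAt (Yd t ht').hasDerivWithinAt (s := Set.Ici t)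
    convert h using 1
    rw [hBT, Ye t ht', hinv1, hBA, map_add, hBT, hBT, add_comm]
  · simp only [Z0, Y0]

theorem intg {X K : Type*} [MeasureSpace X] [SigmaFinite (volume : Measure X)] [NormedAddCommGroup K]
   [MeasureSpace K] [BorelSpace K] [SecondCountableTopology K]
   [SigmaFinite (volume : Measure K)] [(volume : Measure K).IsAddHaarMeasure] [(volume : Measure K).IsNegInvariant]
   (Rhat : ℝ × K → ℂ) (hRmeas : Measurable Rhat) (G : K → ℝ) (hG : Integrable G)
   (hRG : ∀ ω p, ‖Rhat (ω, p)‖ ≤ G p) (u : Lp ℂ 2 (volume : Measure (X × K))) :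
   ∀ᵐ q : X × K, Integrable (fun p => Rhat ((‖p‖ ^ 2 - ‖q.2‖ ^ 2) / 2, p - q.2) * (u (q.1, p) - u q)) := by
  have hu : Measurable u := (Lp.stronglyMeasurable u).measurable
  have hmeas : Measurable (fun r : (X × K) × K => Rhat ((‖r.2‖ ^ 2 - ‖r.1.2‖ ^ 2) / 2, r.2 - r.1.2) * (u (r.1.1, r.2) - u r.1)) := by
    fun_prop
  have hms := measurableSet_integrable (μ := (volume : Measure K)) (f := fun (q : X × K) p => Rhat ((‖p‖ ^ 2 - ‖q.2‖ ^ 2) / 2, p - q.2) * (u (q.1, p) - u q))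
    hmeas.stronglyMeasurable
  refine (Measure.ae_prod_iff_ae_ae hms).2 ?_
  have h2 : Integrable (fun q => ‖u q‖ ^ 2) (volume : Measure (X × K)) := (Lp.memLp u).integrable_norm_pow (by norm_num)
  filter_upwards [Integrable.prod_right_ae (μ := (volume : Measure X)) (ν := (volume : Measure K)) h2] with x hx
  have h3 := Integrable.convolution_integrand (ContinuousLinearMap.mul ℝ ℝ) hx hG.comp_neg
  filter_upwards [h3.prod_right_ae] with k hk
  simp only [ContinuousLinearMap.mul_apply', neg_sub] at hk
  have hGk : Integrable (fun p => G (p - k)) := hG.comp_sub_right k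
  refine ((hk.add hGk).add (hGk.mul_const ‖u (x, k)‖)).mono' ?_ ?_
  · exact (hmeas.comp (measurable_prodMk_left (x := (x, k)))).aestronglyMeasurable
  · refine Eventually.of_forall fun p => ?_
    simp only [Pi.add_apply]
    rw [norm_mul]
    have a1 := hRG ((‖p‖ ^ 2 - ‖k‖ ^ 2) / 2) (p - k)
    have a2 := norm_sub_le (u (x, p)) (u (x, k))
    have a0 := (norm_nonneg _).trans a1
    calc _ ≤ G (p - k) * (‖u (x, p)‖ + ‖u (x, k)‖) := by gcongr
      _ ≤ _ := by
        nlinarith [mul_nonneg a0 (sq_nonneg (‖u (x, p)‖ - 1)), mul_nonneg a0 (sq_nonneg (‖u (x, p)‖))]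

theorem slice1 {X K Z : Type*} [MeasureSpace X] [SigmaFinite (volume : Measure X)]
   [MeasureSpace K] [SigmaFinite (volume : Measure K)] [MeasureSpace Z] [SigmaFinite (volume : Measure Z)]
   {P : (X × K) × Z → Prop} (h : ∀ᵐ q, P q) : ∀ᵐ q : (X × K) × Z, ∀ᵐ p : K, P ((q.1.1, p), q.2) := by
  have hm : Measure.QuasiMeasurePreserving (fun r : ((X × K) × Z) × K => ((r.1.1.1, r.2), r.1.2)) volume volume := by
    have a1 := (volume_preserving_prodAssoc (α₁ := X × K) (β₁ := Z) (γ₁ := K)).quasiMeasurePreserving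
    have a2 := QuasiMeasurePreserving.prodMap (Measure.quasiMeasurePreserving_fst (μ := (volume : Measure X)) (ν := (volume : Measure K)))
      ((Measure.measurePreserving_swap (μ := (volume : Measure Z)) (ν := (volume : Measure K))).quasiMeasurePreserving)
    have a3 := ((volume_preserving_prodAssoc (α₁ := X) (β₁ := K) (γ₁ := Z)).symm).quasiMeasurePreserving
    exact a3.comp (a2.comp a1)
  exact Measure.ae_ae_of_ae_prod (hm.ae h)

theorem slice2 {X K Z : Type*} [MeasureSpace X] [SigmaFinite (volume : Measure X)]
   [MeasureSpace K] [SigmaFinite (volume : Measure K)] [MeasureSpace Z] [SigmaFinite (volume : Measure Z)]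
   {P : Z × X × K → Prop} (h : ∀ᵐ q, P q) : ∀ᵐ q : Z × X × K, ∀ᵐ p : K, P (q.1, (q.2.1, p)) := by
  have hm : Measure.QuasiMeasurePreserving (fun r : (Z × X × K) × K => (r.1.1, (r.1.2.1, r.2))) volume volume := by
    have a1 := (volume_preserving_prodAssoc (α₁ := Z) (β₁ := X × K) (γ₁ := K)).quasiMeasurePreserving
    have a2 := QuasiMeasurePreserving.prodMap (Measure.QuasiMeasurePreserving.id (volume : Measure Z))
      (QuasiMeasurePreserving.prodMap (Measure.quasiMeasurePreserving_fst (μ := (volume : Measure X)) (ν := (volume : Measure K)))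
        (Measure.QuasiMeasurePreserving.id (volume : Measure K)))
    exact a2.comp a1
  exact Measure.ae_ae_of_ae_prod (hm.ae h)

theorem shear {K : Type*} [NormedAddCommGroup K] [NormedSpace ℝ K] 
   [MeasureSpace K] [BorelSpace K] [SecondCountableTopology K]
   [SigmaFinite (volume : Measure K)] [(volume : Measure K).IsAddHaarMeasure] (z : ℝ) :
   MeasurePreserving (fun q : K × K => (q.1 - z • q.2, q.2)) := by
  have h := (MeasurePreserving.id (volume : Measure K)).skew_product (g := fun k x => x - z • k)
    (μc := (volume : Measure K)) (μd := (volume : Measure K)) (by fun_prop)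
    (Eventually.of_forall fun k => (measurePreserving_sub_right volume (z • k)).map_eq)
  have s := Measure.measurePreserving_swap (μ := (volume : Measure K)) (ν := (volume : Measure K))
  exact s.comp (h.comp s)

theorem tens_T {X : Type*} [MeasureSpace X] [SigmaFinite (volume : Measure X)]
   (S : X → X) (hS : MeasurePreserving S)
   (T : Lp ℂ 2 (volume : Measure X) →L[ℂ] Lp ℂ 2 (volume : Measure X))
   (T2 : Lp ℂ 2 (volume : Measure (X × X)) →L[ℂ] Lp ℂ 2 (volume : Measure (X × X)))
   (hT : ∀ u, (T u : X → ℂ) =ᵐ[volume] fun x => u (S x))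
   (hT2 : ∀ u, (T2 u : X × X → ℂ) =ᵐ[volume] fun x => u (S x.1, S x.2))
   (u v : Lp ℂ 2 (volume : Measure X)) : T2 (tens X X u v) = tens X X (T u) (T v) := by
  apply Lp.ext
  have h := (hS.prod hS).quasiMeasurePreserving.ae (tens_ae u v)
  filter_upwards [hT2 (tens X X u v), tens_ae (T u) (T v), ae1 (hT u), ae2 (hT v), h] with q h1 h2 h3 h4 h5
  rw [h1, h2, h3, h4]
  exact h5

theorem tens_L {K : Type*} [NormedAddCommGroup K] 
   [MeasureSpace K] [BorelSpace K] [SecondCountableTopology K]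
   [SigmaFinite (volume : Measure K)] [(volume : Measure K).IsAddHaarMeasure] [(volume : Measure K).IsNegInvariant]
   (Rhat : ℝ × K → ℂ) (hRmeas : Measurable Rhat) (G : K → ℝ) (hG : Integrable G)
   (hRG : ∀ ω p, ‖Rhat (ω, p)‖ ≤ G p) (c : ℝ)
   (Lop : Lp ℂ 2 (volume : Measure (K × K)) →L[ℂ] Lp ℂ 2 (volume : Measure (K × K)))
   (L2op : Lp ℂ 2 (volume : Measure ((K × K) × K × K)) →L[ℂ] Lp ℂ 2 (volume : Measure ((K × K) × K × K)))
   (hLop : ∀ u, (Lop u : K × K → ℂ) =ᵐ[volume] fun xk => c *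
        ∫ p, Rhat ((‖p‖ ^ 2 - ‖xk.2‖ ^ 2) / 2, p - xk.2) * (u (xk.1, p) - u xk))
   (hL2op : ∀ v, (L2op v : (K × K) × K × K → ℂ) =ᵐ[volume] fun z => c *
        ∫ p, (Rhat ((‖p‖ ^ 2 - ‖z.1.2‖ ^ 2) / 2, p - z.1.2) * (v ((z.1.1, p), z.2) - v z)
            + Rhat ((‖p‖ ^ 2 - ‖z.2.2‖ ^ 2) / 2, p - z.2.2) * (v (z.1, (z.2.1, p)) - v z)))
   (u v : Lp ℂ 2 (volume : Measure (K × K))) :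
   L2op (tens _ _ u v) = tens _ _ (Lop u) v + tens _ _ u (Lop v) := by
  set B := tens (K × K) (K × K) with hB
  apply Lp.ext
  filter_upwards [hL2op (B u v), Lp.coeFn_add (B (Lop u) v) (B u (Lop v)), tens_ae (Lop u) v,
    tens_ae u (Lop v), ae1 (hLop u), ae2 (hLop v), tens_ae u v, slice1 (tens_ae u v),
    slice2 (tens_ae u v), ae1 (intg Rhat hRmeas G hG hRG u), ae2 (intg Rhat hRmeas G hG hRG v)]
    with q h1 h2 h3 h4 h5 h6 h7 h8 h9 h10 h11
  rw [h1, h2, Pi.add_apply, h3, h4, h5, h6]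
  have e : ∫ p, (Rhat ((‖p‖ ^ 2 - ‖q.1.2‖ ^ 2) / 2, p - q.1.2) * (B u v ((q.1.1, p), q.2) - B u v q)
          + Rhat ((‖p‖ ^ 2 - ‖q.2.2‖ ^ 2) / 2, p - q.2.2) * (B u v (q.1, (q.2.1, p)) - B u v q))
      = ∫ p, (Rhat ((‖p‖ ^ 2 - ‖q.1.2‖ ^ 2) / 2, p - q.1.2) * (u (q.1.1, p) - u q.1) * v q.2
          + u q.1 * (Rhat ((‖p‖ ^ 2 - ‖q.2.2‖ ^ 2) / 2, p - q.2.2) * (v (q.2.1, p) - v q.2))) := by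
    apply integral_congr_ae
    filter_upwards [h8, h9] with p h12 h13
    rw [h12, h13, h7]
    ring
  rw [e, integral_add (h10.mul_const _) (h11.const_mul _), integral_mul_const, integral_const_mul]
  ring

/-- factorization of the limiting second moment. Let `ℒ`, `T(z)` be the
one-particle scattering operator and free-transport isometry on `H = L²(ℝ^{2d})`, and let
`ℒ₂`, `T₂(z)` be their two-particle counterparts on `L²(ℝ^{4d})`. If `W` solves the mild
transport equation with data `W₀` and `V` solves the two-particle mild equation with data
`W₀ ⊗ W₀`, then `V(z) = W(z) ⊗ W(z)` for every `z ∈ [0,L]`. -/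
theorem stmt13 (d : ℕ) (hd : 1 ≤ d)
    (Rhat : ℝ × EuclideanSpace ℝ (Fin d) → ℂ) (hRmeas : Measurable Rhat)
    (G : EuclideanSpace ℝ (Fin d) → ℝ)
    (hG : Integrable G (volume : Measure (EuclideanSpace ℝ (Fin d))))
    (hRG : ∀ (ω : ℝ) (p : EuclideanSpace ℝ (Fin d)), ‖Rhat (ω, p)‖ ≤ G p)
    -- the one-particle scattering operator ℒ on L²(ℝ^{2d})
    (Lop : Lp ℂ 2 (volume : Measure (EuclideanSpace ℝ (Fin d) × EuclideanSpace ℝ (Fin d))) →L[ℂ]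
           Lp ℂ 2 (volume : Measure (EuclideanSpace ℝ (Fin d) × EuclideanSpace ℝ (Fin d))))
    (hLop : ∀ u : Lp ℂ 2 (volume : Measure (EuclideanSpace ℝ (Fin d) × EuclideanSpace ℝ (Fin d))),
      (Lop u : EuclideanSpace ℝ (Fin d) × EuclideanSpace ℝ (Fin d) → ℂ)
        =ᵐ[(volume : Measure (EuclideanSpace ℝ (Fin d) × EuclideanSpace ℝ (Fin d)))]
      fun xk => (((2 * Real.pi) ^ d)⁻¹ : ℝ) *
        ∫ p, Rhat ((‖p‖ ^ 2 - ‖xk.2‖ ^ 2) / 2, p - xk.2) * (u (xk.1, p) - u xk))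
    -- the one-particle free transport isometry T(z) on L²(ℝ^{2d})
    (T : ℝ → (Lp ℂ 2 (volume : Measure (EuclideanSpace ℝ (Fin d) × EuclideanSpace ℝ (Fin d))) →L[ℂ]
              Lp ℂ 2 (volume : Measure (EuclideanSpace ℝ (Fin d) × EuclideanSpace ℝ (Fin d)))))
    (hT : ∀ (z : ℝ)
        (u : Lp ℂ 2 (volume : Measure (EuclideanSpace ℝ (Fin d) × EuclideanSpace ℝ (Fin d)))),
      (T z u : EuclideanSpace ℝ (Fin d) × EuclideanSpace ℝ (Fin d) → ℂ)
        =ᵐ[(volume : Measure (EuclideanSpace ℝ (Fin d) × EuclideanSpace ℝ (Fin d)))]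
      fun xk => u (xk.1 - z • xk.2, xk.2))
    -- the two-particle scattering operator ℒ₂ on L²(ℝ^{4d})
    (L2op : Lp ℂ 2 (volume : Measure ((EuclideanSpace ℝ (Fin d) × EuclideanSpace ℝ (Fin d)) ×
              EuclideanSpace ℝ (Fin d) × EuclideanSpace ℝ (Fin d))) →L[ℂ]
            Lp ℂ 2 (volume : Measure ((EuclideanSpace ℝ (Fin d) × EuclideanSpace ℝ (Fin d)) ×
              EuclideanSpace ℝ (Fin d) × EuclideanSpace ℝ (Fin d))))
    (hL2op : ∀ v : Lp ℂ 2 (volume : Measure ((EuclideanSpace ℝ (Fin d) × EuclideanSpace ℝ (Fin d)) ×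
              EuclideanSpace ℝ (Fin d) × EuclideanSpace ℝ (Fin d))),
      (L2op v : (EuclideanSpace ℝ (Fin d) × EuclideanSpace ℝ (Fin d)) ×
              EuclideanSpace ℝ (Fin d) × EuclideanSpace ℝ (Fin d) → ℂ)
        =ᵐ[(volume : Measure ((EuclideanSpace ℝ (Fin d) × EuclideanSpace ℝ (Fin d)) ×
              EuclideanSpace ℝ (Fin d) × EuclideanSpace ℝ (Fin d)))]
      fun z => (((2 * Real.pi) ^ d)⁻¹ : ℝ) *
        ∫ p, (Rhat ((‖p‖ ^ 2 - ‖z.1.2‖ ^ 2) / 2, p - z.1.2) * (v ((z.1.1, p), z.2) - v z)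
            + Rhat ((‖p‖ ^ 2 - ‖z.2.2‖ ^ 2) / 2, p - z.2.2) * (v (z.1, (z.2.1, p)) - v z)))
    -- the two-particle free transport isometry T₂(z) on L²(ℝ^{4d})
    (T2 : ℝ → (Lp ℂ 2 (volume : Measure ((EuclideanSpace ℝ (Fin d) × EuclideanSpace ℝ (Fin d)) ×
              EuclideanSpace ℝ (Fin d) × EuclideanSpace ℝ (Fin d))) →L[ℂ]
              Lp ℂ 2 (volume : Measure ((EuclideanSpace ℝ (Fin d) × EuclideanSpace ℝ (Fin d)) ×
              EuclideanSpace ℝ (Fin d) × EuclideanSpace ℝ (Fin d)))))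
    (hT2 : ∀ (z : ℝ)
        (v : Lp ℂ 2 (volume : Measure ((EuclideanSpace ℝ (Fin d) × EuclideanSpace ℝ (Fin d)) ×
              EuclideanSpace ℝ (Fin d) × EuclideanSpace ℝ (Fin d)))),
      (T2 z v : (EuclideanSpace ℝ (Fin d) × EuclideanSpace ℝ (Fin d)) ×
              EuclideanSpace ℝ (Fin d) × EuclideanSpace ℝ (Fin d) → ℂ)
        =ᵐ[(volume : Measure ((EuclideanSpace ℝ (Fin d) × EuclideanSpace ℝ (Fin d)) ×
              EuclideanSpace ℝ (Fin d) × EuclideanSpace ℝ (Fin d)))]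
      fun q => v ((q.1.1 - z • q.1.2, q.1.2), (q.2.1 - z • q.2.2, q.2.2)))
    (L : ℝ) (hL : 0 < L)
    (W₀ : Lp ℂ 2 (volume : Measure (EuclideanSpace ℝ (Fin d) × EuclideanSpace ℝ (Fin d))))
    -- the tensor-square initial data W₀ ⊗ W₀ as an element of L²(ℝ^{4d})
    (W₀₂ : Lp ℂ 2 (volume : Measure ((EuclideanSpace ℝ (Fin d) × EuclideanSpace ℝ (Fin d)) ×
              EuclideanSpace ℝ (Fin d) × EuclideanSpace ℝ (Fin d))))
    (hW₀₂ : (W₀₂ : (EuclideanSpace ℝ (Fin d) × EuclideanSpace ℝ (Fin d)) ×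
              EuclideanSpace ℝ (Fin d) × EuclideanSpace ℝ (Fin d) → ℂ)
        =ᵐ[(volume : Measure ((EuclideanSpace ℝ (Fin d) × EuclideanSpace ℝ (Fin d)) ×
              EuclideanSpace ℝ (Fin d) × EuclideanSpace ℝ (Fin d)))]
      fun q => W₀ q.1 * W₀ q.2)
    (W : ℝ → Lp ℂ 2 (volume : Measure (EuclideanSpace ℝ (Fin d) × EuclideanSpace ℝ (Fin d))))
    (hWcont : ContinuousOn W (Set.Icc 0 L))
    (hW : ∀ z ∈ Set.Icc (0 : ℝ) L,
      W z = T z W₀ + ∫ s in (0 : ℝ)..z, T (z - s) (Lop (W s)))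
    (V : ℝ → Lp ℂ 2 (volume : Measure ((EuclideanSpace ℝ (Fin d) × EuclideanSpace ℝ (Fin d)) ×
              EuclideanSpace ℝ (Fin d) × EuclideanSpace ℝ (Fin d))))
    (hVcont : ContinuousOn V (Set.Icc 0 L))
    (hV : ∀ z ∈ Set.Icc (0 : ℝ) L,
      V z = T2 z W₀₂ + ∫ s in (0 : ℝ)..z, T2 (z - s) (L2op (V s))) :
    ∀ z ∈ Set.Icc (0 : ℝ) L,
      (V z : (EuclideanSpace ℝ (Fin d) × EuclideanSpace ℝ (Fin d)) ×
              EuclideanSpace ℝ (Fin d) × EuclideanSpace ℝ (Fin d) → ℂ)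
        =ᵐ[(volume : Measure ((EuclideanSpace ℝ (Fin d) × EuclideanSpace ℝ (Fin d)) ×
              EuclideanSpace ℝ (Fin d) × EuclideanSpace ℝ (Fin d)))]
      fun q => W z q.1 * W z q.2 := by
  have hflow1 := flow (X := EuclideanSpace ℝ (Fin d) × EuclideanSpace ℝ (Fin d))
    (fun z q => (q.1 - z • q.2, q.2)) (by unfold Function.uncurry; fun_prop) shear (by simp)
    (by intro a b x; simp [add_smul, sub_sub]) T hT
  have : (volume : Measure ((EuclideanSpace ℝ (Fin d) × EuclideanSpace ℝ (Fin d)) ×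
              EuclideanSpace ℝ (Fin d) × EuclideanSpace ℝ (Fin d))).Regular :=
    Measure.Regular.of_sigmaCompactSpace_of_isLocallyFiniteMeasure _
  have hflow2 := flow (X := (EuclideanSpace ℝ (Fin d) × EuclideanSpace ℝ (Fin d)) ×
              EuclideanSpace ℝ (Fin d) × EuclideanSpace ℝ (Fin d))
    (fun z q => ((q.1.1 - z • q.1.2, q.1.2), (q.2.1 - z • q.2.2, q.2.2)))
    (by unfold Function.uncurry; fun_prop) (fun z => (shear z).prod (shear z)) (by simp)
    (by intro a b x; simp [add_smul, sub_sub]) T2 hT2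
  obtain ⟨hc, h0, hadd, -⟩ := hflow1
  obtain ⟨hc2, h02, hadd2, hn2⟩ := hflow2
  set B := tens (EuclideanSpace ℝ (Fin d) × EuclideanSpace ℝ (Fin d))
    (EuclideanSpace ℝ (Fin d) × EuclideanSpace ℝ (Fin d)) with hB
  have hW0 : W₀₂ = B W₀ W₀ := Lp.ext (hW₀₂.trans (tens_ae W₀ W₀).symm)
  rw [hW0] at hV
  have hBT : ∀ z u v, T2 z (B u v) = B (T z u) (T z v) := by
    intro z u v
    exact tens_T _ (shear z) (T z) (T2 z) (hT z) (hT2 z) u v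
  have hBA : ∀ u v, L2op (B u v) = B (Lop u) v + B u (Lop v) := by
    intro u v
    exact tens_L Rhat hRmeas G hG hRG _ Lop L2op hLop hL2op u v
  intro z hz
  rw [abs_main T hc h0 hadd T2 hc2 h02 hadd2 hn2 Lop L2op B hBT hBA L hL W₀ W hWcont hW V hVcont hV z hz]
  exact tens_ae (W z) (W z)
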